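/- Let k ∈ {0, 1} and let G be a triangle-free finite simple graph of maximum degree at most 3 that admits a k-bend CPG representation. Then G admits a k-bend CPG representation such that: (a) any two distinct paths have at most one common point; (b) a path contains in its interior an endpoint of another path if and only if the vertex it represents has degree exactly 3; and (c) no grid point common to two paths is a bend point of either of them. -/

import Mathlib

/-! ## Grid paths and CPG representations -/

/-- Two grid points of `ℤ × ℤ` at L¹-distance 1 (i.e. joined by a unit grid segment). -/
def GridStep (p q : ℤ × ℤ) : Prop :=
  (p.1 - q.1).natAbs + (p.2 - q.2).natAbs = 1

/-- A grid path: a sequence of at least two grid points, consecutive points at distance 1,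
with no repeated grid point (so the traced curve neither crosses nor retraces itself). -/
structure GridPath where
  pts : List (ℤ × ℤ)
  two_le_length : 2 ≤ pts.length
  step : pts.Chain' GridStep
  nodup : pts.Nodup

namespace GridPath

theorem ne_nil (P : GridPath) : P.pts ≠ [] := by
  intro h
  have h2 := P.two_le_length
  rw [h] at h2
  simp at h2

/-- The set of grid points of a grid path. -/
def toSet (P : GridPath) : Set (ℤ × ℤ) := {p | p ∈ P.pts}

/-- The first extreme point of a grid path. -/
def first (P : GridPath) : ℤ × ℤ := P.pts.head P.ne_nil

/-- The second extreme point of a grid path. -/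
def last (P : GridPath) : ℤ × ℤ := P.pts.getLast P.ne_nil

/-- `p` is an endpoint (extreme point) of the grid path `P`. -/
def IsEndpoint (P : GridPath) (p : ℤ × ℤ) : Prop := p = P.first ∨ p = P.last

/-- `p` is an interior grid point of `P`: it lies on `P` but is not an endpoint. -/
def IsInterior (P : GridPath) (p : ℤ × ℤ) : Prop := p ∈ P.toSet ∧ ¬ P.IsEndpoint p

/-- `p` is a bend of `P`: an interior grid point at which `P` turns 90 degrees. -/
def IsBend (P : GridPath) (p : ℤ × ℤ) : Prop :=
  ∃ a c : ℤ × ℤ, [a, p, c] <:+: P.pts ∧ a.1 ≠ c.1 ∧ a.2 ≠ c.2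

/-- The set of bend points of `P`. -/
def bendSet (P : GridPath) : Set (ℤ × ℤ) := {p | P.IsBend p}

/-- `P` has at most `k` bends. -/
def BendsAtMost (P : GridPath) (k : ℕ) : Prop := P.bendSet.ncard ≤ k

end GridPath

/-- `p` and `q` are consecutive grid points of the list `l` (in either order);
equivalently, the path traced by `l` uses the unit grid segment joining `p` and `q`. -/
def ConsecIn (l : List (ℤ × ℤ)) (p q : ℤ × ℤ) : Prop :=
  [p, q] <:+: l ∨ [q, p] <:+: l

/-- A CPG representation of a simple graph `G`: a family of pairwise interiorly disjoint
grid paths, one for each vertex, such that two distinct vertices are adjacent iff the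
corresponding paths have a common point. -/
structure CPGRep {V : Type*} (G : SimpleGraph V) where
  path : V → GridPath
  interiorly_disjoint : ∀ u v : V, u ≠ v → ∀ p : ℤ × ℤ,
    p ∈ (path u).toSet → p ∈ (path v).toSet →
    (path u).IsEndpoint p ∨ (path v).IsEndpoint p
  no_shared_segment : ∀ u v : V, u ≠ v → ∀ p q : ℤ × ℤ,
    ConsecIn (path u).pts p q → ¬ ConsecIn (path v).pts p q
  adj_iff : ∀ u v : V, u ≠ v →
    (G.Adj u v ↔ ∃ p : ℤ × ℤ, p ∈ (path u).toSet ∧ p ∈ (path v).toSet)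

namespace CPGRep

variable {V : Type*} {G : SimpleGraph V}

/-- A `k`-bend CPG representation: every path has at most `k` bends. -/
def BendsAtMost (R : CPGRep G) (k : ℕ) : Prop :=
  ∀ u : V, (R.path u).BendsAtMost k

/-- `p` is a free endpoint of the path of `u`: an endpoint of `R.path u`
belonging to no other path of the representation. -/
def FreeEndpoint (R : CPGRep G) (u : V) (p : ℤ × ℤ) : Prop :=
  (R.path u).IsEndpoint p ∧ ∀ v : V, v ≠ u → p ∉ (R.path v).toSet

end CPGRep

/-- A graph is CPG if it admits a CPG representation. -/
def IsCPG {V : Type*} (G : SimpleGraph V) : Prop := Nonempty (CPGRep G)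

/-- A graph is `B_k`-CPG if it admits a CPG representation in which every path
has at most `k` bends. -/
def IsBkCPG {V : Type*} (G : SimpleGraph V) (k : ℕ) : Prop :=
  ∃ R : CPGRep G, R.BendsAtMost k

/-! ## Auxiliary facts on lists -/

theorem succ_unique {l : List (ℤ × ℤ)} (hl : l.Nodup) {p x y : ℤ × ℤ}
    (h1 : [p, x] <:+: l) (h2 : [p, y] <:+: l) : x = y := by
  rw [List.infix_iff_getElem?] at h1 h2
  obtain ⟨i, hi, h1⟩ := h1
  obtain ⟨j, hj, h2⟩ := h2
  have a0 := h1 0 (by simp)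
  have a1 := h1 1 (by simp)
  have b0 := h2 0 (by simp)
  have b1 := h2 1 (by simp)
  simp only [List.length_cons, List.length_nil] at hi hj
  have : 0 + i = 0 + j := by
    apply (List.getElem?_inj (l := l) (by omega) hl).1
    rw [a0, b0]; rfl
  have hij : i = j := by omega
  subst hij
  rw [a1] at b1
  simpa using b1

theorem pred_unique {l : List (ℤ × ℤ)} (hl : l.Nodup) {p x y : ℤ × ℤ}
    (h1 : [x, p] <:+: l) (h2 : [y, p] <:+: l) : x = y := by
  apply succ_unique (l := l.reverse) (p := p) (by simpa using hl)
  · simpa using List.reverse_infix.2 h1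
  · simpa using List.reverse_infix.2 h2

theorem infix_left {l : List (ℤ × ℤ)} {a b c : ℤ × ℤ} (h : [a, b, c] <:+: l) : [a, b] <:+: l :=
  (List.IsInfix.trans ⟨[], [c], by simp⟩ h)

theorem infix_right {l : List (ℤ × ℤ)} {a b c : ℤ × ℤ} (h : [a, b, c] <:+: l) : [b, c] <:+: l :=
  (List.IsInfix.trans ⟨[a], [], by simp⟩ h)

theorem infix_step {l : List (ℤ × ℤ)} {a b : ℤ × ℤ} (hl : l.IsChain GridStep)
    (h : [a, b] <:+: l) : GridStep a b := by
  have := hl.infix h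
  simpa using this

theorem infix_head_false {l : List (ℤ × ℤ)} (hl : l.Nodup) {p x : ℤ × ℤ}
    (h1 : [x, p] <:+: l) (h2 : l.head? = some p) : False := by
  obtain ⟨s, t, rfl⟩ := h1
  cases s with
  | nil => simp at h2 hl; simp_all
  | cons y s => simp at h2 hl; simp_all

theorem infix_last_false {l : List (ℤ × ℤ)} (hl : l.Nodup) {p x : ℤ × ℤ}
    (h1 : [p, x] <:+: l) (h2 : l.getLast? = some p) : False := by
  apply infix_head_false (l := l.reverse) (p := p) (x := x) (by simpa using hl)
  · simpa using List.reverse_infix.2 h1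
  · simpa using h2

theorem infix_head {l t : List (ℤ × ℤ)} (hl : l.Nodup) {p : ℤ × ℤ} (ht : t <:+: l)
    (hp : p ∈ t) (h : l.head? = some p) : t.head? = some p := by
  obtain ⟨s, r, rfl⟩ := ht
  cases s with
  | nil => cases t with
    | nil => simp at hp
    | cons a t => simpa using h
  | cons y s => simp at h hl; simp_all

theorem infix_last {l t : List (ℤ × ℤ)} (hl : l.Nodup) {p : ℤ × ℤ} (ht : t <:+: l)
    (hp : p ∈ t) (h : l.getLast? = some p) : t.getLast? = some p := by
  have := infix_head (l := l.reverse) (t := t.reverse) (p := p) (by simpa using hl)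
    (List.reverse_infix.2 ht) (by simpa using hp) (by simpa using h)
  simpa using this

namespace GridPath

theorem isEndpoint_iff (P : GridPath) (p : ℤ × ℤ) :
    P.IsEndpoint p ↔ P.pts.head? = some p ∨ P.pts.getLast? = some p := by
  unfold IsEndpoint first last
  rw [List.head?_eq_some_head P.ne_nil, List.getLast?_eq_some_getLast P.ne_nil]
  simp [eq_comm]

theorem IsEndpoint.mem {P : GridPath} {p : ℤ × ℤ} (h : P.IsEndpoint p) : p ∈ P.pts := by
  rcases h with h | h
  · rw [h]; exact List.head_mem _
  · rw [h]; exact List.getLast_mem _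

theorem IsBend.not_endpoint {P : GridPath} {p : ℤ × ℤ} (h : P.IsBend p) : ¬ P.IsEndpoint p := by
  obtain ⟨a, c, h, -⟩ := h
  rw [isEndpoint_iff]
  rintro (h1 | h1)
  · exact infix_head_false P.nodup (infix_left h) h1
  · exact infix_last_false P.nodup (infix_right h) h1

theorem IsBend.mem {P : GridPath} {p : ℤ × ℤ} (h : P.IsBend p) : p ∈ P.pts := by
  obtain ⟨a, c, h, -⟩ := h
  exact h.subset (by simp)

theorem bendSet_finite (P : GridPath) : P.bendSet.Finite :=
  (List.finite_toSet P.pts).subset fun _ h => IsBend.mem h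

/-- A sub-path (infix) of a grid path. -/
def trim (P : GridPath) (t : List (ℤ × ℤ)) (h2 : 2 ≤ t.length) (ht : t <:+: P.pts) : GridPath where
  pts := t
  two_le_length := h2
  step := P.step.infix ht
  nodup := P.nodup.sublist ht.sublist

theorem endpoint_of_infix {P Q : GridPath} (h : Q.pts <:+: P.pts) {p : ℤ × ℤ} (hp : p ∈ Q.pts)
    (he : P.IsEndpoint p) : Q.IsEndpoint p := by
  rw [isEndpoint_iff] at he ⊢
  rcases he with he | he
  · exact Or.inl (infix_head P.nodup h hp he)
  · exact Or.inr (infix_last P.nodup h hp he)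

theorem bend_of_infix {P Q : GridPath} (h : Q.pts <:+: P.pts) {p : ℤ × ℤ}
    (he : Q.IsBend p) : P.IsBend p := by
  obtain ⟨a, c, h1, h2⟩ := he
  exact ⟨a, c, h1.trans h, h2⟩

/-- A path has an edge at each of its points which are endpoints. -/
theorem IsEndpoint.exists_consec {P : GridPath} {p : ℤ × ℤ} (h : P.IsEndpoint p) :
    ∃ d, ConsecIn P.pts p d ∧ GridStep p d ∧ ∀ x, ConsecIn P.pts p x → x = d := by
  have hsym : ∀ a b, GridStep a b → GridStep b a := by
    intro a b; unfold GridStep; omega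
  have hl := P.two_le_length
  have hn := P.nodup
  have hs := P.step
  rw [isEndpoint_iff] at h
  have key : ∀ l : List (ℤ × ℤ), 2 ≤ l.length → l.head? = some p → ∃ d, [p, d] <:+: l := by
    intro l hl hh
    match l, hl, hh with
    | a :: b :: l, _, hh =>
      simp at hh
      exact ⟨b, [], l, by simp [hh]⟩
  rcases h with h | h
  · obtain ⟨d, hd⟩ := key _ hl h
    refine ⟨d, Or.inl hd, infix_step hs hd, ?_⟩
    rintro x (hx | hx)
    · exact succ_unique hn hx hd
    · exact (infix_head_false hn hx h).elim
  · obtain ⟨d, hd⟩ := key P.pts.reverse (by simpa using hl) (by simpa using h)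
    have hd' : [d, p] <:+: P.pts := by simpa using List.reverse_infix.2 hd
    refine ⟨d, Or.inr hd', hsym _ _ (infix_step hs hd'), ?_⟩
    rintro x (hx | hx)
    · exact (infix_last_false hn hx h).elim
    · exact pred_unique hn hx hd'

end GridPath

/-! ## Trimming -/

/-- Trimming the paths of a representation. -/
theorem CPGRep.exists_trim {V : Type} {G : SimpleGraph V} (R : CPGRep G) (Q : V → GridPath)
    (hQ : ∀ u, (Q u).pts <:+: (R.path u).pts)
    (hadj : ∀ u v, G.Adj u v → ∃ p, p ∈ (Q u).pts ∧ p ∈ (Q v).pts) :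
    ∃ R' : CPGRep G, R'.path = Q := by
  refine ⟨⟨Q, ?_, ?_, ?_⟩, rfl⟩
  · intro u v huv p hu hv
    rcases R.interiorly_disjoint u v huv p ((hQ u).subset hu) ((hQ v).subset hv) with h | h
    · exact Or.inl (GridPath.endpoint_of_infix (hQ u) hu h)
    · exact Or.inr (GridPath.endpoint_of_infix (hQ v) hv h)
  · intro u v huv p q h1 h2
    refine R.no_shared_segment u v huv p q ?_ ?_
    · exact h1.imp (fun h => h.trans (hQ u)) (fun h => h.trans (hQ u))
    · exact h2.imp (fun h => h.trans (hQ v)) (fun h => h.trans (hQ v))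
  · intro u v huv
    constructor
    · intro h; exact hadj u v h
    · rintro ⟨p, hu, hv⟩
      exact (R.adj_iff u v huv).2 ⟨p, (hQ u).subset hu, (hQ v).subset hv⟩

/-- At most two paths pass through a point. -/
theorem CPGRep.two_paths {V : Type} {G : SimpleGraph V} (R : CPGRep G) (htf : G.CliqueFree 3)
    {u v w : V} {p : ℤ × ℤ} (huv : u ≠ v) (hu : p ∈ (R.path u).pts) (hv : p ∈ (R.path v).pts)
    (hw : p ∈ (R.path w).pts) : w = u ∨ w = v := by
  classical
  by_contra! h
  apply htf {u, v, w}
  rw [SimpleGraph.is3Clique_triple_iff]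
  exact ⟨(R.adj_iff u v huv).2 ⟨p, hu, hv⟩, (R.adj_iff u w h.1.symm).2 ⟨p, hu, hw⟩,
    (R.adj_iff v w h.2.symm).2 ⟨p, hv, hw⟩⟩

/-! ## Subdivisions -/

/-- Image of a list of grid points under a vertex map `φ`, where the edge `ab` gets
the optional middle point `m a b`. -/
def subdiv (φ : ℤ × ℤ → ℤ × ℤ) (m : ℤ × ℤ → ℤ × ℤ → Option (ℤ × ℤ)) :
    List (ℤ × ℤ) → List (ℤ × ℤ)
  | [] => []
  | [a] => [φ a]
  | a :: b :: l => φ a :: ((m a b).toList ++ subdiv φ m (b :: l))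

section subdiv
variable (φ : ℤ × ℤ → ℤ × ℤ) (m : ℤ × ℤ → ℤ × ℤ → Option (ℤ × ℤ))

theorem subdiv_cons (a : ℤ × ℤ) (l : List (ℤ × ℤ)) : ∃ t, subdiv φ m (a :: l) = φ a :: t := by
  cases l with
  | nil => exact ⟨[], rfl⟩
  | cons b l => exact ⟨_, rfl⟩

theorem subdiv_head (l : List (ℤ × ℤ)) : (subdiv φ m l).head? = l.head?.map φ := by
  cases l with
  | nil => rfl
  | cons a l => obtain ⟨t, ht⟩ := subdiv_cons φ m a l; simp [ht]

theorem subdiv_last : ∀ l : List (ℤ × ℤ), (subdiv φ m l).getLast? = l.getLast?.map φ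
  | [] => rfl
  | [a] => rfl
  | a :: b :: l => by
    have ih := subdiv_last (b :: l)
    obtain ⟨t, ht⟩ := subdiv_cons φ m b l
    rw [subdiv]
    rw [List.getLast?_cons_cons, ← ih, ht]
    cases m a b <;> simp [List.getLast?_cons]

theorem pair_infix_cons {a b c d : ℤ × ℤ} {l : List (ℤ × ℤ)} :
    [c, d] <:+: a :: b :: l ↔ (c = a ∧ d = b) ∨ [c, d] <:+: b :: l := by
  rw [List.infix_cons_iff]; simp

theorem mem_subdiv (x : ℤ × ℤ) : ∀ l : List (ℤ × ℤ), x ∈ subdiv φ m l ↔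
    (∃ a ∈ l, φ a = x) ∨ ∃ a b, [a, b] <:+: l ∧ m a b = some x
  | [] => by simp [subdiv]
  | [a] => by
    simp only [subdiv, List.mem_singleton]
    constructor
    · intro h; exact Or.inl ⟨a, by simp, h.symm⟩
    · rintro (⟨b, hb, rfl⟩ | ⟨b, c, h, -⟩)
      · simp_all
      · have := h.length_le; simp at this
  | a :: b :: l => by
    have ih := mem_subdiv x (b :: l)
    simp only [subdiv, List.mem_cons, List.mem_append, ih, Option.mem_toList] at *
    constructor
    · rintro (h | h | ⟨c, hc, h⟩ | ⟨c, d, h, h'⟩)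
      · exact Or.inl ⟨a, by simp, h.symm⟩
      · exact Or.inr ⟨a, b, pair_infix_cons.2 (Or.inl ⟨rfl, rfl⟩), h⟩
      · exact Or.inl ⟨c, by simp [hc], h⟩
      · exact Or.inr ⟨c, d, pair_infix_cons.2 (Or.inr h), h'⟩
    · rintro (⟨c, hc | hc, h⟩ | ⟨c, d, h, h'⟩)
      · subst hc; simp [h]
      · exact Or.inr (Or.inr (Or.inl ⟨c, hc, h⟩))
      · rcases pair_infix_cons.1 h with ⟨rfl, rfl⟩ | h
        · exact Or.inr (Or.inl h')
        · exact Or.inr (Or.inr (Or.inr ⟨c, d, h, h'⟩))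

/-- The subdivision of the edge from `a` to `b`. -/
def edgeList (a b : ℤ × ℤ) : List (ℤ × ℤ) := φ a :: ((m a b).toList ++ [φ b])

theorem subdiv_chain : ∀ l : List (ℤ × ℤ),
    (∀ a b, [a, b] <:+: l → (edgeList φ m a b).IsChain GridStep) →
    (subdiv φ m l).IsChain GridStep
  | [], _ => by simp [subdiv]
  | [a], _ => by simp [subdiv]
  | a :: b :: l, h => by
    have ih := subdiv_chain (b :: l) fun c d hc => h c d (pair_infix_cons.2 (Or.inr hc))
    have h0 := h a b (pair_infix_cons.2 (Or.inl ⟨rfl, rfl⟩))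
    obtain ⟨t, ht⟩ := subdiv_cons φ m b l
    rw [ht] at ih
    rw [subdiv, ht]
    clear h
    unfold edgeList at h0
    cases hm : m a b <;> simp_all

theorem subdiv_nodup (hφ : Function.Injective φ) : ∀ l : List (ℤ × ℤ), l.Nodup →
    (∀ a b, [a, b] <:+: l → ∀ x, m a b = some x → ∀ q, φ q ≠ x) →
    (∀ a b c d, [a, b] <:+: l → [c, d] <:+: l → ∀ x, m a b = some x → m c d = some x →
      (a = c ∧ b = d) ∨ (a = d ∧ b = c)) →
    (subdiv φ m l).Nodup
  | [], _, _, _ => by simp [subdiv]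
  | [a], _, _, _ => by simp [subdiv]
  | a :: b :: l, hn, h1, h2 => by
    have ih := subdiv_nodup hφ (b :: l) (List.nodup_cons.1 hn).2
      (fun c d hc => h1 c d (pair_infix_cons.2 (Or.inr hc)))
      (fun c d e f hc he => h2 c d e f (pair_infix_cons.2 (Or.inr hc))
        (pair_infix_cons.2 (Or.inr he)))
    have hab : [a, b] <:+: a :: b :: l := pair_infix_cons.2 (Or.inl ⟨rfl, rfl⟩)
    have ha : a ∉ b :: l := (List.nodup_cons.1 hn).1
    have hA : φ a ∉ subdiv φ m (b :: l) := by
      rw [mem_subdiv]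
      rintro (⟨c, hc, h⟩ | ⟨c, d, h, h'⟩)
      · exact ha (hφ h ▸ hc)
      · exact h1 c d (pair_infix_cons.2 (Or.inr h)) _ h' a rfl
    have hM : ∀ x, m a b = some x → x ∉ subdiv φ m (b :: l) := by
      intro x hx
      rw [mem_subdiv]
      rintro (⟨c, hc, h⟩ | ⟨c, d, h, h'⟩)
      · exact h1 a b hab x hx c h
      · rcases h2 a b c d hab (pair_infix_cons.2 (Or.inr h)) x hx h' with ⟨rfl, rfl⟩ | ⟨rfl, rfl⟩
        · exact ha (h.subset (by simp))
        · exact ha (h.subset (by simp))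
    have hAM := h1 a b hab
    rw [subdiv]
    cases hm : m a b with
    | none => simp [hA, ih]
    | some x =>
      simp [hA, ih, hM x hm]
      exact hAM x hm a

theorem subdiv_pair (x y : ℤ × ℤ) : ∀ l : List (ℤ × ℤ), [x, y] <:+: subdiv φ m l →
    ∃ a b, [a, b] <:+: l ∧ [x, y] <:+: edgeList φ m a b
  | [], h => by have := h.length_le; simp [subdiv] at this
  | [a], h => by have := h.length_le; simp [subdiv] at this
  | a :: b :: l, h => by
    have ih := subdiv_pair x y (b :: l)
    have key : [x, y] <:+: edgeList φ m a b ∨ [x, y] <:+: subdiv φ m (b :: l) := by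
      obtain ⟨t, ht⟩ := subdiv_cons φ m b l
      rw [subdiv, ht] at h
      rw [ht]
      unfold edgeList
      cases hm : m a b with
      | none =>
        simp only [hm, Option.toList_none, List.nil_append, pair_infix_cons] at h ⊢
        tauto
      | some z =>
        simp only [hm, Option.toList_some, List.cons_append, List.nil_append,
          pair_infix_cons] at h ⊢
        tauto
    rcases key with h | h
    · exact ⟨a, b, pair_infix_cons.2 (Or.inl ⟨rfl, rfl⟩), h⟩
    · obtain ⟨c, d, h1, h2⟩ := ih h
      exact ⟨c, d, pair_infix_cons.2 (Or.inr h1), h2⟩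

theorem triple_infix_cons {a b c x y z : ℤ × ℤ} {l : List (ℤ × ℤ)} :
    [x, y, z] <:+: a :: b :: c :: l ↔ (x = a ∧ y = b ∧ z = c) ∨ [x, y, z] <:+: b :: c :: l := by
  rw [List.infix_cons_iff]; simp

theorem not_triple_infix {a b x y z : ℤ × ℤ} : ¬ [x, y, z] <:+: [a, b] := by
  intro h; have := h.length_le; simp at this

theorem triple_infix_of {a x y z : ℤ × ℤ} {l : List (ℤ × ℤ)} (h : [x, y, z] <:+: l) :
    [x, y, z] <:+: a :: l := h.trans (List.infix_cons (List.infix_refl _))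

theorem subdiv_triple (x y z : ℤ × ℤ) : ∀ l : List (ℤ × ℤ), [x, y, z] <:+: subdiv φ m l →
    (∃ a b c, [a, b, c] <:+: l ∧ y = φ b ∧ x = (m a b).getD (φ a) ∧ z = (m b c).getD (φ c)) ∨
    (∃ a b, [a, b] <:+: l ∧ m a b = some y ∧ x = φ a ∧ z = φ b)
  | [], h => by have := h.length_le; simp [subdiv] at this
  | [a], h => by have := h.length_le; simp [subdiv] at this
  | [a, b], h => by
    right
    refine ⟨a, b, List.infix_refl _, ?_⟩
    simp only [subdiv] at h
    cases hm : m a b with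
    | none => simp [hm, not_triple_infix] at h
    | some w =>
      simp only [hm, Option.toList_some, List.cons_append, List.nil_append,
        triple_infix_cons, not_triple_infix, or_false] at h
      obtain ⟨rfl, rfl, rfl⟩ := h
      simp
  | a :: b :: c :: l, h => by
    have ih := subdiv_triple x y z (b :: c :: l)
    have hab : [a, b] <:+: a :: b :: c :: l := pair_infix_cons.2 (Or.inl ⟨rfl, rfl⟩)
    have habc : [a, b, c] <:+: a :: b :: c :: l := triple_infix_cons.2 (Or.inl ⟨rfl, rfl, rfl⟩)
    have key : (y = φ b ∧ x = (m a b).getD (φ a) ∧ z = (m b c).getD (φ c)) ∨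
        (m a b = some y ∧ x = φ a ∧ z = φ b) ∨ [x, y, z] <:+: subdiv φ m (b :: c :: l) := by
      obtain ⟨t, ht⟩ := subdiv_cons φ m c l
      rw [subdiv, subdiv, ht] at h
      rw [subdiv, ht]
      cases hm : m a b <;> cases hm' : m b c <;>
        simp only [hm, hm', Option.toList_none, Option.toList_some, List.cons_append,
          List.nil_append, triple_infix_cons, Option.getD_some, Option.getD_none,
          Option.some.injEq, reduceCtorEq] at h ⊢ <;> grind
    rcases key with h | h | h
    · exact Or.inl ⟨a, b, c, habc, h⟩
    · exact Or.inr ⟨a, b, hab, h⟩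
    · rcases ih h with ⟨a', b', c', h1, h2⟩ | ⟨a', b', h1, h2⟩
      · exact Or.inl ⟨a', b', c', triple_infix_of h1, h2⟩
      · exact Or.inr ⟨a', b', pair_infix_cons.2 (Or.inr h1), h2⟩

theorem subdiv_length : ∀ l : List (ℤ × ℤ), l.length ≤ (subdiv φ m l).length
  | [] => by simp
  | [a] => by simp [subdiv]
  | a :: b :: l => by
    have := subdiv_length (b :: l)
    simp [subdiv] at *
    omega

end subdiv

/-- Subdividing a representation. -/
theorem CPGRep.exists_subdiv {V : Type} {G : SimpleGraph V} (R : CPGRep G)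
    (φ : ℤ × ℤ → ℤ × ℤ) (m : ℤ × ℤ → ℤ × ℤ → Option (ℤ × ℤ)) (hφ : Function.Injective φ)
    (hstep : ∀ u a b, [a, b] <:+: (R.path u).pts → (edgeList φ m a b).IsChain GridStep)
    (hrange : ∀ u a b, [a, b] <:+: (R.path u).pts → ∀ x, m a b = some x → ∀ q, φ q ≠ x)
    (hmid : ∀ u v a b c d, [a, b] <:+: (R.path u).pts → [c, d] <:+: (R.path v).pts →
      ∀ x, m a b = some x → m c d = some x → (a = c ∧ b = d) ∨ (a = d ∧ b = c)) :
    ∃ R' : CPGRep G, (∀ u, (R'.path u).pts = subdiv φ m (R.path u).pts) ∧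
      (∀ u v, u ≠ v → ∀ x, x ∈ (R'.path u).pts → x ∈ (R'.path v).pts →
        ∃ p, φ p = x ∧ p ∈ (R.path u).pts ∧ p ∈ (R.path v).pts) := by
  let Q : V → GridPath := fun u =>
    { pts := subdiv φ m (R.path u).pts
      two_le_length := (R.path u).two_le_length.trans (subdiv_length φ m _)
      step := subdiv_chain φ m _ (hstep u)
      nodup := subdiv_nodup φ m hφ _ (R.path u).nodup (hrange u)
        (fun a b c d => hmid u u a b c d) }
  have hcontact : ∀ u v, u ≠ v → ∀ x, x ∈ (Q u).pts → x ∈ (Q v).pts →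
        ∃ p, φ p = x ∧ p ∈ (R.path u).pts ∧ p ∈ (R.path v).pts := by
    intro u v huv x hu hv
    simp only [Q, mem_subdiv] at hu hv
    rcases hu with ⟨a, ha, rfl⟩ | ⟨a, b, hab, hx⟩
    · rcases hv with ⟨c, hc, h⟩ | ⟨c, d, hcd, hx⟩
      · exact ⟨a, rfl, ha, hφ h ▸ hc⟩
      · exact (hrange v c d hcd _ hx a rfl).elim
    · rcases hv with ⟨c, hc, h⟩ | ⟨c, d, hcd, hx'⟩
      · exact (hrange u a b hab _ hx c h).elim
      · exfalso
        refine R.no_shared_segment u v huv a b (Or.inl hab) ?_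
        rcases hmid u v a b c d hab hcd x hx hx' with ⟨rfl, rfl⟩ | ⟨rfl, rfl⟩
        · exact Or.inl hcd
        · exact Or.inr hcd
  have hend : ∀ u p, (R.path u).IsEndpoint p → (Q u).IsEndpoint (φ p) := by
    intro u p h
    rw [GridPath.isEndpoint_iff] at h ⊢
    simp only [Q, subdiv_head, subdiv_last]
    rcases h with h | h <;> simp [h]
  have hseg : ∀ u v, u ≠ v → ∀ x y, [x, y] <:+: (Q u).pts →
      x ∈ (Q v).pts → y ∈ (Q v).pts → ∃ a b, φ a = x ∧ φ b = y ∧ [a, b] <:+: (R.path u).pts := by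
    intro u v huv x y h hx hy
    obtain ⟨p, rfl, -, -⟩ := hcontact u v huv x (h.subset (by simp)) hx
    obtain ⟨q, rfl, -, -⟩ := hcontact u v huv y (h.subset (by simp)) hy
    obtain ⟨a, b, hab, h'⟩ := subdiv_pair φ m _ _ _ h
    unfold edgeList at h'
    cases hm : m a b with
    | none =>
      simp only [hm, Option.toList_none, List.nil_append, pair_infix_cons] at h'
      rcases h' with ⟨h1, h2⟩ | h'
      · exact ⟨a, b, h1.symm, h2.symm, hab⟩
      · have := h'.length_le; simp at this
    | some z =>
      have hz := hrange u a b hab z hm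
      simp only [hm, Option.toList_some, List.cons_append, List.nil_append, pair_infix_cons] at h'
      rcases h' with ⟨h1, h2⟩ | ⟨h1, h2⟩ | h'
      · exact (hz _ h2).elim
      · exact (hz _ h1).elim
      · have := h'.length_le; simp at this
  refine ⟨⟨Q, ?_, ?_, ?_⟩, fun u => rfl, hcontact⟩
  · intro u v huv x hu hv
    obtain ⟨p, rfl, hpu, hpv⟩ := hcontact u v huv x hu hv
    exact (R.interiorly_disjoint u v huv p hpu hpv).imp (hend u p) (hend v p)
  · intro u v huv x y h1 h2
    have h2x : x ∈ (Q v).pts := by rcases h2 with h | h <;> exact h.subset (by simp)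
    have h2y : y ∈ (Q v).pts := by rcases h2 with h | h <;> exact h.subset (by simp)
    have h1x : x ∈ (Q u).pts := by rcases h1 with h | h <;> exact h.subset (by simp)
    have h1y : y ∈ (Q u).pts := by rcases h1 with h | h <;> exact h.subset (by simp)
    have e1 : ∃ a b, φ a = x ∧ φ b = y ∧ ConsecIn (R.path u).pts a b := by
      rcases h1 with h | h
      · obtain ⟨a, b, ha, hb, hab⟩ := hseg u v huv x y h h2x h2y
        exact ⟨a, b, ha, hb, Or.inl hab⟩
      · obtain ⟨a, b, ha, hb, hab⟩ := hseg u v huv y x h h2y h2x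
        exact ⟨b, a, hb, ha, Or.inr hab⟩
    have e2 : ∃ a b, φ a = x ∧ φ b = y ∧ ConsecIn (R.path v).pts a b := by
      rcases h2 with h | h
      · obtain ⟨a, b, ha, hb, hab⟩ := hseg v u huv.symm x y h h1x h1y
        exact ⟨a, b, ha, hb, Or.inl hab⟩
      · obtain ⟨a, b, ha, hb, hab⟩ := hseg v u huv.symm y x h h1y h1x
        exact ⟨b, a, hb, ha, Or.inr hab⟩
    obtain ⟨a, b, ha, hb, hab⟩ := e1
    obtain ⟨c, d, hc, hd, hcd⟩ := e2
    obtain rfl : a = c := hφ (ha.trans hc.symm)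
    obtain rfl : b = d := hφ (hb.trans hd.symm)
    exact R.no_shared_segment u v huv a b hab hcd
  · intro u v huv
    rw [R.adj_iff u v huv]
    constructor
    · rintro ⟨p, hu, hv⟩
      exact ⟨φ p, (mem_subdiv φ m _ _).2 (Or.inl ⟨p, hu, rfl⟩),
        (mem_subdiv φ m _ _).2 (Or.inl ⟨p, hv, rfl⟩)⟩
    · rintro ⟨x, hu, hv⟩
      obtain ⟨p, -, hp⟩ := hcontact u v huv x hu hv
      exact ⟨p, hp⟩

theorem gridStep_cases {a b : ℤ × ℤ} (h : GridStep a b) :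
    b = (a.1 + 1, a.2) ∨ b = (a.1 - 1, a.2) ∨ b = (a.1, a.2 + 1) ∨ b = (a.1, a.2 - 1) := by
  unfold GridStep at h
  obtain ⟨a1, a2⟩ := a
  obtain ⟨b1, b2⟩ := b
  simp only [Prod.mk.injEq] at *
  omega

/-! ## The measure -/

section measure
variable {V : Type} {G : SimpleGraph V}

/-- The contacts of a representation. -/
def CPGRep.contacts (R : CPGRep G) : Set (V × V × (ℤ × ℤ)) :=
  {t | t.1 ≠ t.2.1 ∧ t.2.2 ∈ (R.path t.1).pts ∧ t.2.2 ∈ (R.path t.2.1).pts}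

/-- The contacts of a representation at bends of the first path. -/
def CPGRep.bendContacts (R : CPGRep G) : Set (V × V × (ℤ × ℤ)) :=
  {t | t ∈ R.contacts ∧ (R.path t.1).IsBend t.2.2}

theorem CPGRep.contacts_finite [Fintype V] (R : CPGRep G) : R.contacts.Finite := by
  have : (⋃ u, {p | p ∈ (R.path u).pts}).Finite :=
    Set.finite_iUnion fun u => List.finite_toSet _
  refine ((Set.finite_univ (α := V)).prod ((Set.finite_univ (α := V)).prod this)).subset ?_
  rintro ⟨u, v, p⟩ ⟨-, h, -⟩
  simp only [Set.mem_prod, Set.mem_univ, true_and, Set.mem_iUnion]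
  exact ⟨u, h⟩

theorem CPGRep.bendContacts_finite [Fintype V] (R : CPGRep G) : R.bendContacts.Finite :=
  R.contacts_finite.subset fun _ h => h.1

/-- The measure to be minimised. -/
noncomputable def CPGRep.meas (R : CPGRep G) : ℕ := R.contacts.ncard + R.bendContacts.ncard

/-! ## Scaling -/

theorem CPGRep.exists_scale [Fintype V] (R : CPGRep G) {k : ℕ} (hk : R.BendsAtMost k) :
    ∃ R' : CPGRep G, R'.BendsAtMost k ∧ R'.meas ≤ R.meas ∧
      (∀ u, 3 ≤ (R'.path u).pts.length) ∧
      ∀ u v p, p ∈ (R.path u).pts → p ∈ (R.path v).pts →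
        (2 * p.1, 2 * p.2) ∈ (R'.path u).pts ∧ (2 * p.1, 2 * p.2) ∈ (R'.path v).pts := by
  let φ : ℤ × ℤ → ℤ × ℤ := fun p => (2 * p.1, 2 * p.2)
  let m : ℤ × ℤ → ℤ × ℤ → Option (ℤ × ℤ) := fun a b => some (a.1 + b.1, a.2 + b.2)
  have hst : ∀ u a b, [a, b] <:+: (R.path u).pts → GridStep a b :=
    fun u a b h => infix_step (R.path u).step h
  have hφ : Function.Injective φ := by
    rintro ⟨a, b⟩ ⟨c, d⟩ h
    simp only [φ, Prod.mk.injEq] at h ⊢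
    omega
  obtain ⟨R', hR', hc⟩ := R.exists_subdiv φ m hφ
    (by
      intro u a b hab
      have := hst u a b hab
      simp only [edgeList, φ, m, GridStep, Option.toList_some, List.cons_append, List.nil_append,
        List.isChain_cons_cons, List.isChain_singleton, and_true] at this ⊢
      omega)
    (by
      intro u a b hab x hx q hq
      have := hst u a b hab
      simp only [m, φ, GridStep, Option.some.injEq] at this hx hq
      subst hx
      simp only [Prod.mk.injEq] at hq
      omega)
    (by
      intro u v a b c d hab hcd x hx hx'
      have h1 := hst u a b hab
      have h2 := hst v c d hcd
      obtain ⟨a1, a2⟩ := a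
      obtain ⟨c1, c2⟩ := c
      simp only [m, Option.some.injEq] at hx hx'
      subst hx
      simp only [Prod.mk.injEq] at hx'
      rcases gridStep_cases h1 with rfl | rfl | rfl | rfl <;>
      rcases gridStep_cases h2 with rfl | rfl | rfl | rfl <;>
      simp only [Prod.mk.injEq] at hx' ⊢ <;> omega)
  have hbend : ∀ u x, (R'.path u).IsBend x → ∃ p, φ p = x ∧ (R.path u).IsBend p := by
    rintro u x ⟨y, z, h, hb⟩
    rw [hR' u] at h
    rcases subdiv_triple φ m _ _ _ _ h with ⟨a, b, c, h1, rfl, rfl, rfl⟩ | ⟨a, b, h1, h2, rfl, rfl⟩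
    · refine ⟨b, rfl, a, c, h1, ?_⟩
      simp only [m, Option.getD_some] at hb
      omega
    · have := hst u a b h1
      simp only [φ, GridStep] at hb this
      omega
  refine ⟨R', ?_, ?_, ?_, ?_⟩
  · intro u
    refine le_trans ?_ (hk u)
    have : (R'.path u).bendSet ⊆ Set.image φ ((R.path u).bendSet) := by
      intro x hx
      obtain ⟨p, hp, hb⟩ := hbend u x hx
      exact ⟨p, hb, hp⟩
    exact (Set.ncard_le_ncard this ((R.path u).bendSet_finite.image _)).trans
      (Set.ncard_image_le (R.path u).bendSet_finite)
  · let Φ : V × V × (ℤ × ℤ) → V × V × (ℤ × ℤ) := fun t => (t.1, t.2.1, φ t.2.2)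
    have h1 : R'.contacts ⊆ Set.image Φ (R.contacts) := by
      rintro ⟨u, v, x⟩ ⟨huv, hu, hv⟩
      obtain ⟨p, rfl, hp⟩ := hc u v huv x hu hv
      exact ⟨(u, v, p), ⟨huv, hp⟩, rfl⟩
    have h2 : R'.bendContacts ⊆ Set.image Φ (R.bendContacts) := by
      rintro ⟨u, v, x⟩ ⟨⟨huv, hu, hv⟩, hb⟩
      obtain ⟨p, rfl, hp⟩ := hc u v huv x hu hv
      obtain ⟨q, hq, hb'⟩ := hbend u _ hb
      obtain rfl := hφ hq
      exact ⟨(u, v, q), ⟨⟨huv, hp⟩, hb'⟩, rfl⟩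
    unfold CPGRep.meas
    have h3 := (Set.ncard_le_ncard h1 (R.contacts_finite.image _)).trans
      (Set.ncard_image_le R.contacts_finite)
    have h4 := (Set.ncard_le_ncard h2 (R.bendContacts_finite.image _)).trans
      (Set.ncard_image_le R.bendContacts_finite)
    omega
  · intro u
    rw [hR' u]
    have h2 := (R.path u).two_le_length
    generalize (R.path u).pts = l at h2
    match l, h2 with
    | a :: b :: l, _ =>
      have := subdiv_length φ m (b :: l)
      simp only [subdiv, m, Option.toList_some, List.length_cons, List.length_append,
        List.length_nil] at this ⊢
      omega
  · intro u v p hu hv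
    rw [hR' u, hR' v, mem_subdiv, mem_subdiv]
    exact ⟨Or.inl ⟨p, hu, rfl⟩, Or.inl ⟨p, hv, rfl⟩⟩

/-- Removing a superfluous contact. -/
theorem CPGRep.remove_contact [Fintype V] (R : CPGRep G) (htf : G.CliqueFree 3)
    {k : ℕ} (hk : R.BendsAtMost k) {u v : V} (huv : u ≠ v) {p q : ℤ × ℤ} (hpq : p ≠ q)
    (hpu : p ∈ (R.path u).pts) (hpv : p ∈ (R.path v).pts)
    (hqu : q ∈ (R.path u).pts) (hqv : q ∈ (R.path v).pts)
    (he : (R.path u).IsEndpoint p) (h3 : 3 ≤ (R.path u).pts.length) :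
    ∃ R' : CPGRep G, R'.BendsAtMost k ∧ R'.meas < R.meas := by
  classical
  obtain ⟨t, ht, ht2, htm⟩ : ∃ t, t <:+: (R.path u).pts ∧ 2 ≤ t.length ∧
      ∀ x, x ∈ t ↔ x ∈ (R.path u).pts ∧ x ≠ p := by
    rw [GridPath.isEndpoint_iff] at he
    have hn := (R.path u).nodup
    generalize (R.path u).pts = l at *
    rcases he with he | he
    · cases l with
      | nil => simp at he
      | cons a l =>
        simp only [List.head?_cons, Option.some.injEq] at he
        subst he
        refine ⟨l, List.infix_cons (List.infix_refl _), by simpa using h3, ?_⟩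
        intro x
        rw [List.nodup_cons] at hn
        simp only [List.mem_cons]
        constructor
        · intro h; exact ⟨Or.inr h, fun h' => hn.1 (h' ▸ h)⟩
        · rintro ⟨h | h, h'⟩
          · exact (h' h).elim
          · exact h
    · obtain ⟨s, rfl⟩ := List.getLast?_eq_some_iff.1 he
      refine ⟨s, ⟨[], [p], by simp⟩, by simpa using h3, ?_⟩
      intro x
      have hps : p ∉ s := by
        intro h
        have := List.disjoint_of_nodup_append hn h
        simp at this
      simp only [List.mem_append, List.mem_singleton]
      constructor
      · intro h; exact ⟨Or.inl h, fun h' => hps (h' ▸ h)⟩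
      · rintro ⟨h | h, h'⟩
        · exact h
        · exact (h' h).elim
  let Q : V → GridPath := Function.update R.path u ((R.path u).trim t ht2 ht)
  have hQu : (Q u).pts = t := by simp [Q, GridPath.trim]
  have hQw : ∀ w, w ≠ u → Q w = R.path w := by intro w hw; simp [Q, hw]
  have hQ : ∀ w, (Q w).pts <:+: (R.path w).pts := by
    intro w
    by_cases hw : w = u
    · subst hw; rw [hQu]; exact ht
    · rw [hQw w hw]
  have hux : ∀ w, w ≠ u → G.Adj u w → ∃ x, x ∈ (Q u).pts ∧ x ∈ (Q w).pts := by
    intro w hwu hadj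
    rw [hQw w hwu, hQu]
    by_cases hwv : w = v
    · subst hwv
      exact ⟨q, (htm q).2 ⟨hqu, hpq.symm⟩, hqv⟩
    · obtain ⟨x, hxu, hxw⟩ := (R.adj_iff u w hwu.symm).1 hadj
      refine ⟨x, (htm x).2 ⟨hxu, ?_⟩, hxw⟩
      rintro rfl
      rcases R.two_paths htf huv hpu hpv hxw with h | h
      · exact hwu h
      · exact hwv h
  obtain ⟨R', hR'⟩ := R.exists_trim Q hQ (by
    intro a b hab
    by_cases hau : a = u
    · subst hau
      exact hux b hab.ne' hab
    · by_cases hbu : b = u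
      · subst hbu
        obtain ⟨x, h1, h2⟩ := hux a hau hab.symm
        exact ⟨x, h2, h1⟩
      · rw [hQw a hau, hQw b hbu]
        exact (R.adj_iff a b hab.ne).1 hab)
  refine ⟨R', ?_, ?_⟩
  · intro w
    refine le_trans ?_ (hk w)
    refine Set.ncard_le_ncard ?_ (R.path w).bendSet_finite
    intro x hx
    rw [hR'] at hx
    exact GridPath.bend_of_infix (hQ w) hx
  · have h1 : R'.contacts ⊆ R.contacts := by
      rintro ⟨a, b, x⟩ ⟨hab, ha, hb⟩
      rw [hR'] at ha hb
      exact ⟨hab, (hQ a).subset ha, (hQ b).subset hb⟩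
    have h2 : R'.bendContacts ⊆ R.bendContacts := by
      rintro ⟨a, b, x⟩ ⟨h, hb⟩
      rw [hR'] at hb
      exact ⟨h1 h, GridPath.bend_of_infix (hQ a) hb⟩
    have h3 : R'.contacts ⊂ R.contacts := by
      refine (Set.ssubset_iff_of_subset h1).2 ⟨(u, v, p), ⟨huv, hpu, hpv⟩, ?_⟩
      rintro ⟨-, h, -⟩
      rw [hR'] at h
      simp only [hQu] at h
      exact ((htm p).1 h).2 rfl
    have h4 := Set.ncard_lt_ncard h3 R.contacts_finite
    have h5 := Set.ncard_le_ncard h2 R.bendContacts_finite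
    unfold CPGRep.meas
    omega

theorem CPGRep.reduce_multiple [Fintype V] (R : CPGRep G) (htf : G.CliqueFree 3)
    {k : ℕ} (hk : R.BendsAtMost k) {u v : V} (huv : u ≠ v) {p q : ℤ × ℤ} (hpq : p ≠ q)
    (hpu : p ∈ (R.path u).pts) (hpv : p ∈ (R.path v).pts)
    (hqu : q ∈ (R.path u).pts) (hqv : q ∈ (R.path v).pts) :
    ∃ R' : CPGRep G, R'.BendsAtMost k ∧ R'.meas < R.meas := by
  obtain ⟨S, hSk, hSm, hS3, hS⟩ := R.exists_scale hk
  obtain ⟨h1, h2⟩ := hS u v p hpu hpv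
  obtain ⟨h3, h4⟩ := hS u v q hqu hqv
  have hne : ((2 * p.1, 2 * p.2) : ℤ × ℤ) ≠ (2 * q.1, 2 * q.2) := by
    intro h
    apply hpq
    simp only [Prod.mk.injEq] at h
    ext <;> omega
  rcases S.interiorly_disjoint u v huv _ h1 h2 with he | he
  · obtain ⟨R', h5, h6⟩ := S.remove_contact htf hSk huv hne h1 h2 h3 h4 he (hS3 u)
    exact ⟨R', h5, by omega⟩
  · obtain ⟨R', h5, h6⟩ := S.remove_contact htf hSk huv.symm hne h2 h1 h4 h3 he (hS3 v)
    exact ⟨R', h5, by omega⟩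

/-! ## Splitting a grid line -/

/-- Points moved upwards by the split. -/
def Upper (q : ℤ × ℤ) : Prop := 0 < q.2 ∨ (q.2 = 0 ∧ q.1 < 0)

instance (q : ℤ × ℤ) : Decidable (Upper q) := by unfold Upper; infer_instance

/-- The split on points. -/
def splitPt (q : ℤ × ℤ) : ℤ × ℤ := (q.1, if Upper q then q.2 + 1 else q.2)

/-- The split on edges. -/
def splitMid (a b : ℤ × ℤ) : Option (ℤ × ℤ) :=
  if (Upper a ↔ Upper b) then none
  else some (max a.1 b.1, if max a.1 b.1 < 0 then 0 else 1)

theorem splitPt_injective : Function.Injective splitPt := by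
  rintro ⟨a, b⟩ ⟨c, d⟩ h
  simp only [splitPt, Upper, Prod.mk.injEq] at h ⊢
  split_ifs at h <;> omega

theorem splitMid_range {a b x : ℤ × ℤ} (h : splitMid a b = some x) (q : ℤ × ℤ) :
    splitPt q ≠ x := by
  intro hq
  unfold splitMid at h
  split_ifs at h <;>
  · simp only [Option.some.injEq] at h
    subst h
    simp only [splitPt, Upper, Prod.mk.injEq] at hq
    split_ifs at hq <;> omega

theorem split_chain {a b : ℤ × ℤ} (h : GridStep a b) :
    (edgeList splitPt splitMid a b).IsChain GridStep := by
  obtain ⟨a1, a2⟩ := a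
  unfold edgeList splitMid
  rcases gridStep_cases h with rfl | rfl | rfl | rfl <;> split_ifs with h1 h2 <;>
    simp only [Option.toList_none, Option.toList_some, List.nil_append, List.cons_append,
      List.isChain_cons_cons, List.isChain_singleton, and_true, splitPt, GridStep] <;>
    simp only [Upper] at h1 ⊢ <;> split_ifs <;> omega

theorem splitMid_some {a b x : ℤ × ℤ} (h : splitMid a b = some x) :
    ¬ (Upper a ↔ Upper b) ∧ x.1 = max a.1 b.1 := by
  unfold splitMid at h
  by_cases g : Upper a ↔ Upper b
  · rw [if_pos g] at h; simp at h
  · rw [if_neg g, Option.some.injEq] at h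
    exact ⟨g, by rw [← h]⟩

theorem splitMid_edge_aux {a b : ℤ × ℤ} {t : ℤ} (hab : GridStep a b) (ha : ¬ Upper a)
    (hb : Upper b) (hx : t = max a.1 b.1) (e1 : a = (0, 0) → b ≠ (0, 1)) :
    a = (t, if t < 0 then -1 else 0) ∧
      b = (if t = 0 then -1 else t, if t ≤ 0 then 0 else 1) := by
  obtain ⟨a1, a2⟩ := a
  rcases gridStep_cases hab with rfl | rfl | rfl | rfl
  · simp only [Upper] at ha hb hx
    omega
  · simp only [Upper] at ha hb hx
    obtain rfl : a1 = 0 := by omega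
    obtain rfl : a2 = 0 := by omega
    obtain rfl : t = 0 := by omega
    simp
  · simp only [Upper] at ha hb hx
    obtain rfl : t = a1 := by omega
    rcases lt_trichotomy t 0 with h | h | h
    · obtain rfl : a2 = -1 := by omega
      rw [if_pos h, if_neg (by omega), if_pos (by omega)]
      simp
    · subst h
      obtain rfl : a2 = 0 := by omega
      simp at e1
    · obtain rfl : a2 = 0 := by omega
      rw [if_neg (by omega), if_neg (by omega), if_neg (by omega)]
      simp
  · simp only [Upper] at ha hb hx
    omega

/-- The edge with a given middle point. -/
theorem splitMid_edge {a b x : ℤ × ℤ} (hab : GridStep a b) (h1 : splitMid a b = some x)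
    (e1 : a = (0, 0) → b ≠ (0, 1)) (e2 : b = (0, 0) → a ≠ (0, 1)) :
    (a = (x.1, if x.1 < 0 then -1 else 0) ∧
      b = (if x.1 = 0 then -1 else x.1, if x.1 ≤ 0 then 0 else 1)) ∨
    (b = (x.1, if x.1 < 0 then -1 else 0) ∧
      a = (if x.1 = 0 then -1 else x.1, if x.1 ≤ 0 then 0 else 1)) := by
  obtain ⟨g, hx⟩ := splitMid_some h1
  have hba : GridStep b a := by unfold GridStep at *; omega
  by_cases ha : Upper a
  · exact Or.inr (splitMid_edge_aux hba (fun hb => g ⟨fun _ => hb, fun _ => ha⟩) ha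
      (by rw [hx, max_comm]) e2)
  · exact Or.inl (splitMid_edge_aux hab ha
      (by by_contra hb; exact g ⟨fun h => absurd h ha, fun h => absurd h hb⟩) hx e1)

theorem splitMid_inj {a b c d x : ℤ × ℤ} (hab : GridStep a b) (hcd : GridStep c d)
    (h1 : splitMid a b = some x) (h2 : splitMid c d = some x)
    (e1 : a = (0, 0) → b ≠ (0, 1)) (e2 : b = (0, 0) → a ≠ (0, 1))
    (e3 : c = (0, 0) → d ≠ (0, 1)) (e4 : d = (0, 0) → c ≠ (0, 1)) :
    (a = c ∧ b = d) ∨ (a = d ∧ b = c) := by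
  rcases splitMid_edge hab h1 e1 e2 with ⟨f1, f2⟩ | ⟨f1, f2⟩ <;>
  rcases splitMid_edge hcd h2 e3 e4 with ⟨f3, f4⟩ | ⟨f3, f4⟩ <;>
  rw [f1, f2, f3, f4] <;> simp

theorem splitMid_comm (a b : ℤ × ℤ) : splitMid a b = splitMid b a := by
  unfold splitMid
  by_cases g : Upper a ↔ Upper b
  · rw [if_pos g, if_pos g.symm]
  · have g' : ¬ (Upper b ↔ Upper a) := fun h => g h.symm
    rw [if_neg g, if_neg g', max_comm]

theorem split_dir {a b : ℤ × ℤ} (hb : b ≠ (0, 0)) (h : GridStep b a) :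
    (splitMid b a).getD (splitPt a) =
      ((splitPt b).1 + a.1 - b.1, (splitPt b).2 + a.2 - b.2) := by
  obtain ⟨a1, a2⟩ := a
  obtain ⟨b1, b2⟩ := b
  unfold GridStep at h
  unfold splitMid splitPt
  rw [ne_eq, Prod.mk.injEq] at hb
  by_cases ha : Upper (a1, a2) <;> by_cases hc : Upper (b1, b2) <;>
    simp only [ha, hc, if_true, if_false, iff_true, iff_false, not_true_eq_false,
      not_false_eq_true, Option.getD_some, Option.getD_none, Prod.mk.injEq] <;>
    simp only [Upper] at ha hc h
  · omega
  · constructor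
    · omega
    · split_ifs <;> omega
  · constructor
    · omega
    · split_ifs <;> omega
  · omega

theorem split_bend {a b c : ℤ × ℤ} (hab : GridStep a b) (hbc : GridStep b c)
    (h0 : b = (0, 0) → (a = (-1, 0) ∧ c = (0, -1)) ∨ (a = (0, -1) ∧ c = (-1, 0)))
    (h1 : ((splitMid a b).getD (splitPt a)).1 ≠ ((splitMid b c).getD (splitPt c)).1)
    (h2 : ((splitMid a b).getD (splitPt a)).2 ≠ ((splitMid b c).getD (splitPt c)).2) :
    b ≠ (0, 0) ∧ a.1 ≠ c.1 ∧ a.2 ≠ c.2 := by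
  have hb : b ≠ (0, 0) := by
    intro hb
    subst hb
    rcases h0 rfl with ⟨rfl, rfl⟩ | ⟨rfl, rfl⟩
    · simp [splitMid, splitPt, Upper] at h1
    · simp [splitMid, splitPt, Upper] at h1
  refine ⟨hb, ?_⟩
  have hba : GridStep b a := by unfold GridStep at *; omega
  rw [splitMid_comm a b, split_dir hb hba, split_dir hb hbc] at h1 h2
  simp only at h1 h2
  omega

theorem split_mid_bend {a b x : ℤ × ℤ} (hab : GridStep a b) (h : splitMid a b = some x)
    (h1 : (splitPt a).1 ≠ (splitPt b).1) :
    x = (0, 1) ∧ ((a = (-1, 0) ∧ b = (0, 0)) ∨ (a = (0, 0) ∧ b = (-1, 0))) := by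
  obtain ⟨a1, a2⟩ := a
  obtain ⟨b1, b2⟩ := b
  have g := (splitMid_some h).1
  unfold splitMid at h
  rw [if_neg g, Option.some.injEq] at h
  simp only [splitPt] at h1
  unfold GridStep at hab
  simp only [Upper, Prod.mk.injEq] at *
  have hm : max a1 b1 = 0 := by omega
  rw [← h, hm]
  refine ⟨by simp, ?_⟩
  omega

theorem exists_isometry {p l e : ℤ × ℤ} (hl : GridStep p l) (he : GridStep p e)
    (h1 : l.1 ≠ e.1) (h2 : l.2 ≠ e.2) : ∃ ψ : ℤ × ℤ → ℤ × ℤ, Function.Injective ψ ∧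
      (∀ a b, GridStep a b → GridStep (ψ a) (ψ b)) ∧
      (∀ a c, (ψ a).1 ≠ (ψ c).1 ∧ (ψ a).2 ≠ (ψ c).2 ↔ a.1 ≠ c.1 ∧ a.2 ≠ c.2) ∧
      ψ p = (0, 0) ∧ ψ l = (-1, 0) ∧ ψ e = (0, -1) ∧
      ψ (2 * p.1 - l.1, 2 * p.2 - l.2) = (1, 0) := by
  obtain ⟨p1, p2⟩ := p
  have key : ∃ s t : ℤ, (s = 1 ∨ s = -1) ∧ (t = 1 ∨ t = -1) ∧
      ((l = (p1 + s, p2) ∧ e = (p1, p2 + t)) ∨ (l = (p1, p2 + s) ∧ e = (p1 + t, p2))) := by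
    rcases gridStep_cases hl with rfl | rfl | rfl | rfl <;>
    rcases gridStep_cases he with rfl | rfl | rfl | rfl <;>
    simp only [ne_eq, not_true_eq_false] at h1 h2 
    · exact ⟨1, 1, by simp⟩
    · exact ⟨1, -1, by simp; rfl⟩
    · exact ⟨-1, 1, by simp; rfl⟩
    · exact ⟨-1, -1, Or.inr rfl, Or.inr rfl, Or.inl ⟨rfl, rfl⟩⟩
    · exact ⟨1, 1, by simp⟩
    · exact ⟨1, -1, by simp; rfl⟩
    · exact ⟨-1, 1, by simp; rfl⟩
    · exact ⟨-1, -1, Or.inr rfl, Or.inr rfl, Or.inr ⟨rfl, rfl⟩⟩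
  obtain ⟨s, t, hs, ht, ⟨rfl, rfl⟩ | ⟨rfl, rfl⟩⟩ := key
  · refine ⟨fun q => (-s * (q.1 - p1), -t * (q.2 - p2)), ?_, ?_, ?_, ?_, ?_, ?_, ?_⟩ <;>
    rcases hs with rfl | rfl <;> rcases ht with rfl | rfl
    all_goals first
      | (rintro ⟨a, b⟩ ⟨c, d⟩ h; simp only [Prod.mk.injEq] at h ⊢; omega)
      | (rintro ⟨a, b⟩ ⟨c, d⟩; simp only [GridStep]; omega)
      | (simp only [Prod.mk.injEq]; omega)
  · refine ⟨fun q => (-s * (q.2 - p2), -t * (q.1 - p1)), ?_, ?_, ?_, ?_, ?_, ?_, ?_⟩ <;>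
    rcases hs with rfl | rfl <;> rcases ht with rfl | rfl
    all_goals first
      | (rintro ⟨a, b⟩ ⟨c, d⟩ h; simp only [Prod.mk.injEq] at h ⊢; omega)
      | (rintro ⟨a, b⟩ ⟨c, d⟩; simp only [GridStep]; omega)
      | (simp only [Prod.mk.injEq]; omega)

theorem CPGRep.split_aux [Fintype V] (R : CPGRep G) (htf : G.CliqueFree 3)
    {k : ℕ} (hk : R.BendsAtMost k) {u v : V} (huv : u ≠ v) {p l e d : ℤ × ℤ}
    (hpu : p ∈ (R.path u).pts) (hpv : p ∈ (R.path v).pts) (hbp : (R.path u).IsBend p)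
    (hl : GridStep p l) (he : GridStep p e) (hle1 : l.1 ≠ e.1) (hle2 : l.2 ≠ e.2)
    (hd : d = (2 * p.1 - l.1, 2 * p.2 - l.2))
    (hcu : ∀ x, ConsecIn (R.path u).pts p x → x = l ∨ x = e)
    (hcl : ConsecIn (R.path u).pts p l)
    (hcv : ∀ x, ConsecIn (R.path v).pts p x → x = d)
    (htu : ∀ x y, [x, p, y] <:+: (R.path u).pts → (x = l ∧ y = e) ∨ (x = e ∧ y = l))
    (htv : ∀ x y, ¬ [x, p, y] <:+: (R.path v).pts) :
    ∃ R' : CPGRep G, R'.BendsAtMost k ∧ R'.meas < R.meas := by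
  classical
  obtain ⟨ψ, hψ, hψs, hψb, hψp, hψl, hψe, hψd⟩ := exists_isometry hl he hle1 hle2
  rw [← hd] at hψd
  have hst : ∀ w a b, [a, b] <:+: (R.path w).pts → GridStep (ψ a) (ψ b) :=
    fun w a b h => hψs _ _ (infix_step (R.path w).step h)
  have h0 : ∀ x, ψ x = (0, 0) → x = p := fun x h => hψ (h.trans hψp.symm)
  have hcons : ∀ w x, ConsecIn (R.path w).pts p x → ψ x ≠ (0, 1) := by
    intro w x h
    have hpw : p ∈ (R.path w).pts := by rcases h with h | h <;> exact h.subset (by simp)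
    rcases R.two_paths htf huv hpu hpv hpw with rfl | rfl
    · rcases hcu x h with rfl | rfl
      · simp [hψl]
      · simp [hψe]
    · rw [hcv x h, hψd]; simp
  let φ : ℤ × ℤ → ℤ × ℤ := fun q => splitPt (ψ q)
  let m : ℤ × ℤ → ℤ × ℤ → Option (ℤ × ℤ) := fun a b => splitMid (ψ a) (ψ b)
  have hφ : Function.Injective φ := splitPt_injective.comp hψ
  obtain ⟨R', hR', hc⟩ := R.exists_subdiv φ m hφ
    (fun w a b hab => split_chain (hst w a b hab))
    (fun w a b hab x hx q => splitMid_range hx (ψ q))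
    (by
      intro w z a b c d hab hcd x hx hx'
      have := splitMid_inj (hst w a b hab) (hst z c d hcd) hx hx'
        (fun h => hcons w b (Or.inl (h0 _ h ▸ hab)))
        (fun h => hcons w a (Or.inr (h0 _ h ▸ hab)))
        (fun h => hcons z d (Or.inl (h0 _ h ▸ hcd)))
        (fun h => hcons z c (Or.inr (h0 _ h ▸ hcd)))
      exact this.imp (fun h => ⟨hψ h.1, hψ h.2⟩) (fun h => ⟨hψ h.1, hψ h.2⟩))
  have hbend : ∀ w x, (R'.path w).IsBend x →
      (∃ q, φ q = x ∧ (R.path w).IsBend q ∧ q ≠ p) ∨ (w = u ∧ x = (0, 1)) := by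
    rintro w x ⟨y, z, h, hb1, hb2⟩
    rw [hR' w] at h
    rcases subdiv_triple φ m _ _ _ _ h with ⟨a, b, c, h1, rfl, rfl, rfl⟩ | ⟨a, b, h1, h2, rfl, rfl⟩
    · left
      obtain ⟨g1, g2⟩ := split_bend (hst w a b (infix_left h1)) (hst w b c (infix_right h1)) (by
        intro hb
        obtain rfl := h0 _ hb
        rcases R.two_paths htf huv hpu hpv (h1.subset (by simp) : b ∈ (R.path w).pts)
          with rfl | rfl
        · rcases htu a c h1 with ⟨rfl, rfl⟩ | ⟨rfl, rfl⟩
          · exact Or.inl ⟨hψl, hψe⟩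
          · exact Or.inr ⟨hψe, hψl⟩
        · exact (htv a c h1).elim) hb1 hb2
      refine ⟨b, rfl, ⟨a, c, h1, (hψb a c).1 g2⟩, ?_⟩
      rintro rfl
      exact g1 hψp
    · right
      obtain ⟨g1, g2⟩ := split_mid_bend (hst w a b h1) h2 hb1
      refine ⟨?_, g1⟩
      by_contra hwu
      refine R.no_shared_segment u w (Ne.symm hwu) p l hcl ?_
      rcases g2 with ⟨g2, g3⟩ | ⟨g2, g3⟩
      · obtain rfl := h0 _ g3
        obtain rfl : a = l := hψ (g2.trans hψl.symm)
        exact Or.inr h1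
      · obtain rfl := h0 _ g2
        obtain rfl : b = l := hψ (g3.trans hψl.symm)
        exact Or.inl h1
  refine ⟨R', ?_, ?_⟩
  · intro w
    refine le_trans ?_ (hk w)
    let g : ℤ × ℤ → ℤ × ℤ := fun q => if w = u ∧ q = p then (0, 1) else φ q
    have : (R'.path w).bendSet ⊆ Set.image g ((R.path w).bendSet) := by
      intro x hx
      rcases hbend w x hx with ⟨q, hq, hb, hqp⟩ | ⟨rfl, rfl⟩
      · exact ⟨q, hb, by simp [g, hqp, hq]⟩
      · exact ⟨p, hbp, by simp [g]⟩
    exact (Set.ncard_le_ncard this ((R.path w).bendSet_finite.image _)).trans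
      (Set.ncard_image_le (R.path w).bendSet_finite)
  · let Φ : V × V × (ℤ × ℤ) → V × V × (ℤ × ℤ) := fun t => (t.1, t.2.1, φ t.2.2)
    have h1 : R'.contacts ⊆ Set.image Φ (R.contacts) := by
      rintro ⟨u, v, x⟩ ⟨huv, hu, hv⟩
      obtain ⟨p, rfl, hp⟩ := hc u v huv x hu hv
      exact ⟨(u, v, p), ⟨huv, hp⟩, rfl⟩
    have hmem : (u, v, p) ∈ R.bendContacts := ⟨⟨huv, hpu, hpv⟩, hbp⟩
    have h2 : R'.bendContacts ⊆ Set.image Φ ((R.bendContacts \ {(u, v, p)})) := by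
      rintro ⟨w, z, x⟩ ⟨⟨hwz, hw, hz⟩, hb⟩
      obtain ⟨q', hq', hp⟩ := hc w z hwz x hw hz
      simp only at hb hq'
      rcases hbend w x hb with ⟨q, hq, hb', hqp⟩ | ⟨-, rfl⟩
      · obtain rfl := hφ (hq.trans hq'.symm)
        refine ⟨(w, z, q), ⟨⟨⟨hwz, hp⟩, hb'⟩, ?_⟩, by simp [Φ, hq]⟩
        simp [hqp]
      · exfalso
        have : splitMid (0, 0) (-1, 0) = some (0, 1) := by simp [splitMid, Upper]
        exact splitMid_range this _ hq'
    unfold CPGRep.meas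
    have hf : (R.bendContacts \ {(u, v, p)}).Finite := R.bendContacts_finite.sdiff
    have h3 := (Set.ncard_le_ncard h1 (R.contacts_finite.image _)).trans
      (Set.ncard_image_le R.contacts_finite)
    have h4 := (Set.ncard_le_ncard h2 (hf.image _)).trans (Set.ncard_image_le hf)
    have h5 := Set.ncard_sdiff_singleton_lt_of_mem hmem R.bendContacts_finite
    omega

theorem CPGRep.reduce_bend [Fintype V] (R : CPGRep G) (htf : G.CliqueFree 3)
    {k : ℕ} (hk : R.BendsAtMost k) {u v : V} (huv : u ≠ v) {p : ℤ × ℤ}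
    (hpv : p ∈ (R.path v).pts) (hbp : (R.path u).IsBend p) :
    ∃ R' : CPGRep G, R'.BendsAtMost k ∧ R'.meas < R.meas := by
  have hsym : ∀ a b, GridStep a b → GridStep b a := by
    intro a b; unfold GridStep; omega
  have hpu := hbp.mem
  have hev : (R.path v).IsEndpoint p :=
    (R.interiorly_disjoint u v huv p hpu hpv).resolve_left hbp.not_endpoint
  obtain ⟨d, hd, hpd, hdu⟩ := hev.exists_consec
  obtain ⟨a, c, hac, hb1, hb2⟩ := id hbp
  have hn := (R.path u).nodup
  have hpa : GridStep p a := hsym _ _ (infix_step (R.path u).step (infix_left hac))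
  have hpc : GridStep p c := infix_step (R.path u).step (infix_right hac)
  have hca : ConsecIn (R.path u).pts p a := Or.inr (infix_left hac)
  have hcc : ConsecIn (R.path u).pts p c := Or.inl (infix_right hac)
  have hda : d ≠ a := by
    rintro rfl; exact R.no_shared_segment u v huv _ _ hca hd
  have hdc : d ≠ c := by
    rintro rfl; exact R.no_shared_segment u v huv _ _ hcc hd
  have hcu : ∀ x, ConsecIn (R.path u).pts p x → x = a ∨ x = c := by
    rintro x (h | h)
    · exact Or.inr (succ_unique hn h (infix_right hac))
    · exact Or.inl (pred_unique hn h (infix_left hac))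
  have htu : ∀ x y, [x, p, y] <:+: (R.path u).pts → x = a ∧ y = c := by
    intro x y h
    exact ⟨pred_unique hn (infix_left h) (infix_left hac),
      succ_unique hn (infix_right h) (infix_right hac)⟩
  have htv : ∀ x y, ¬ [x, p, y] <:+: (R.path v).pts := by
    intro x y h
    rw [GridPath.isEndpoint_iff] at hev
    rcases hev with h' | h'
    · exact infix_head_false (R.path v).nodup (infix_left h) h'
    · exact infix_last_false (R.path v).nodup (infix_right h) h'
  have hcase : d = (2 * p.1 - a.1, 2 * p.2 - a.2) ∨ d = (2 * p.1 - c.1, 2 * p.2 - c.2) := by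
    clear hcu htu htv hca hcc hdu hd
    obtain ⟨p1, p2⟩ := p
    rcases gridStep_cases hpa with rfl | rfl | rfl | rfl <;>
    rcases gridStep_cases hpc with rfl | rfl | rfl | rfl <;>
    rcases gridStep_cases hpd with rfl | rfl | rfl | rfl <;>
    simp only [Prod.mk.injEq, ne_eq, not_true_eq_false] at hb1 hb2 hda hdc ⊢ <;> omega
  rcases hcase with h | h
  · exact R.split_aux htf hk huv hpu hpv hbp hpa hpc hb1 hb2 h hcu hca hdu
      (fun x y hxy => Or.inl (htu x y hxy)) htv
  · exact R.split_aux htf hk huv hpu hpv hbp hpc hpa hb1.symm hb2.symm h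
      (fun x hx => (hcu x hx).symm) hcc hdu
      (fun x y hxy => Or.inr (htu x y hxy)) htv

/-- A representation with (a) and (c). -/
theorem CPGRep.exists_good [Fintype V] (htf : G.CliqueFree 3) {k : ℕ} :
    ∀ (n : ℕ) (R : CPGRep G), R.meas = n → R.BendsAtMost k →
    ∃ R' : CPGRep G, R'.BendsAtMost k ∧
      (∀ u v, u ≠ v → ∀ p q, p ∈ (R'.path u).pts → p ∈ (R'.path v).pts →
        q ∈ (R'.path u).pts → q ∈ (R'.path v).pts → p = q) ∧
      (∀ u v, u ≠ v → ∀ p, p ∈ (R'.path v).pts → ¬ (R'.path u).IsBend p) := by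
  intro n
  induction n using Nat.strong_induction_on with
  | _ n ih =>
    intro R hn hk
    have key : (∃ R' : CPGRep G, R'.BendsAtMost k ∧ R'.meas < R.meas) ∨
      ((∀ u v, u ≠ v → ∀ p q, p ∈ (R.path u).pts → p ∈ (R.path v).pts →
        q ∈ (R.path u).pts → q ∈ (R.path v).pts → p = q) ∧
      (∀ u v, u ≠ v → ∀ p, p ∈ (R.path v).pts → ¬ (R.path u).IsBend p)) := by
      by_contra! h
      obtain ⟨h1, h2⟩ := h
      obtain ⟨u, v, huv, p, hp, hb⟩ := h2 (by
        intro u v huv p q h3 h4 h5 h6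
        by_contra hpq
        obtain ⟨R', h7, h8⟩ := R.reduce_multiple htf hk huv hpq h3 h4 h5 h6
        have := h1 R' h7
        omega)
      obtain ⟨R', h7, h8⟩ := R.reduce_bend htf hk huv hp hb
      have := h1 R' h7
      omega
    rcases key with ⟨R', h1, h2⟩ | h
    · exact ih R'.meas (hn ▸ h2) R' rfl h1
    · exact ⟨R, hk, h⟩

end measure

/-! ## Final trimming -/

theorem exists_infix_ends {l : List (ℤ × ℤ)} (h2 : 2 ≤ l.length) (C : Set (ℤ × ℤ))
    (hC : ∀ c ∈ C, c ∈ l) (hc : C.ncard ≤ 2) :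
    ∃ t, t <:+: l ∧ 2 ≤ t.length ∧
      ∀ c ∈ C, c ∈ t ∧ (t.head? = some c ∨ t.getLast? = some c) := by
  have hf : C.Finite := (List.finite_toSet l).subset hC
  have key : C.Subsingleton ∨ ∃ c d, c ≠ d ∧ C = {c, d} := by
    rcases Nat.lt_or_ge C.ncard 2 with h | h
    · left
      intro a ha b hb
      exact (Set.ncard_le_one hf).1 (by omega) a ha b hb
    · right
      exact Set.ncard_eq_two.1 (le_antisymm hc h)
  rcases key with h | ⟨c, d, hcd, rfl⟩
  · rcases C.eq_empty_or_nonempty with rfl | ⟨c, hcC⟩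
    · exact ⟨l, List.infix_refl _, h2, by simp⟩
    · obtain ⟨s, r, rfl⟩ := List.append_of_mem (hC c hcC)
      cases r with
      | nil =>
        refine ⟨_, List.infix_refl _, h2, ?_⟩
        intro x hx
        obtain rfl := h hx hcC
        simp
      | cons y r =>
        refine ⟨c :: y :: r, ⟨s, [], by simp⟩, by simp, ?_⟩
        intro x hx
        obtain rfl := h hx hcC
        simp
  · obtain ⟨s, r, rfl⟩ := List.append_of_mem (hC c (by simp))
    have hd := hC d (by simp)
    rw [List.mem_append, List.mem_cons] at hd
    rcases hd with hd | hd | hd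
    · obtain ⟨s1, s2, rfl⟩ := List.append_of_mem hd
      refine ⟨d :: s2 ++ [c], ⟨s1, r, by simp⟩, by simp, ?_⟩
      rintro x (rfl | rfl)
      · exact ⟨by simp, Or.inr (List.getLast?_eq_some_iff.2 ⟨_, rfl⟩)⟩
      · exact ⟨by simp, Or.inl (by simp)⟩
    · exact (hcd hd.symm).elim
    · obtain ⟨s1, s2, rfl⟩ := List.append_of_mem hd
      refine ⟨c :: s1 ++ [d], ⟨s, s2, by simp⟩, by simp, ?_⟩
      rintro x (rfl | rfl)
      · exact ⟨by simp, Or.inl (by simp)⟩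
      · exact ⟨by simp, Or.inr (List.getLast?_eq_some_iff.2 ⟨_, rfl⟩)⟩

/-- Lemma: for `k ∈ {0,1}`, every triangle-free graph of maximum degree at most 3 that is
`B_k`-CPG admits a `k`-bend CPG representation in which (a) any two distinct paths have
at most one common point, (b) a path contains in its interior an endpoint of another path
iff its vertex is cubic, and (c) no contact point is a bend point of any of its paths. -/
theorem nice_representation_of_subcubic_triangle_free
    (k : ℕ) (hk : k = 0 ∨ k = 1) (V : Type) [Fintype V] (G : SimpleGraph V)
    (htf : G.CliqueFree 3) (hdeg : ∀ v : V, (G.neighborSet v).ncard ≤ 3)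
    (hG : IsBkCPG G k) :
    ∃ R : CPGRep G, R.BendsAtMost k ∧
      (∀ u v : V, u ≠ v →
        Set.Subsingleton ((R.path u).toSet ∩ (R.path v).toSet)) ∧
      (∀ u : V,
        (∃ v : V, v ≠ u ∧ ∃ p : ℤ × ℤ,
          (R.path v).IsEndpoint p ∧ (R.path u).IsInterior p) ↔
        (G.neighborSet u).ncard = 3) ∧
      (∀ u v : V, u ≠ v → ∀ p : ℤ × ℤ, p ∈ (R.path u).toSet → p ∈ (R.path v).toSet →
        ¬ (R.path u).IsBend p ∧ ¬ (R.path v).IsBend p) := by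
  classical
  obtain ⟨R0, hR0⟩ := hG
  obtain ⟨R, hk', ha, hc⟩ := CPGRep.exists_good htf _ R0 rfl hR0
  -- the contact points of a vertex
  let C : V → Set (ℤ × ℤ) := fun u => {p | p ∈ (R.path u).pts ∧ ∃ v, v ≠ u ∧ p ∈ (R.path v).pts}
  have hCcard : ∀ u, (C u).ncard ≤ (G.neighborSet u).ncard := by
    intro u
    have hex : ∀ p, ∃ v, p ∈ C u → v ≠ u ∧ p ∈ (R.path v).pts := by
      intro p
      by_cases h : p ∈ C u
      · obtain ⟨v, hv⟩ := h.2
        exact ⟨v, fun _ => hv⟩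
      · exact ⟨u, fun h' => (h h').elim⟩
    choose f hf using hex
    refine Set.ncard_le_ncard_of_injOn f ?_ ?_ (Set.toFinite _)
    · intro p hp
      exact (R.adj_iff u (f p) (hf p hp).1.symm).2 ⟨p, hp.1, (hf p hp).2⟩
    · intro p hp q hq hpq
      refine ha u (f p) (hf p hp).1.symm p q hp.1 (hf p hp).2 hq.1 ?_
      rw [hpq]
      exact (hf q hq).2
  have hQex : ∀ u, ∃ Q : GridPath, Q.pts <:+: (R.path u).pts ∧ (∀ p ∈ C u, p ∈ Q.pts) ∧
      ((G.neighborSet u).ncard ≠ 3 → ∀ p ∈ C u, Q.IsEndpoint p) := by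
    intro u
    by_cases h3 : (G.neighborSet u).ncard = 3
    · exact ⟨R.path u, List.infix_refl _, fun p hp => hp.1, fun h => (h h3).elim⟩
    · obtain ⟨t, ht, ht2, hte⟩ := exists_infix_ends (R.path u).two_le_length (C u)
        (fun c hc => hc.1) (by have := hCcard u; have := hdeg u; omega)
      refine ⟨(R.path u).trim t ht2 ht, ht, fun p hp => (hte p hp).1, fun _ p hp => ?_⟩
      rw [GridPath.isEndpoint_iff]
      exact (hte p hp).2
  choose Q hQ hQC hQe using hQex
  have hmem : ∀ u v, u ≠ v → ∀ p, p ∈ (R.path u).pts → p ∈ (R.path v).pts →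
      p ∈ (Q u).pts ∧ p ∈ (Q v).pts := fun u v huv p hu hv =>
    ⟨hQC u p ⟨hu, v, huv.symm, hv⟩, hQC v p ⟨hv, u, huv, hu⟩⟩
  obtain ⟨R', hR'⟩ := R.exists_trim Q hQ (by
    intro u v huv
    obtain ⟨p, hu, hv⟩ := (R.adj_iff u v huv.ne).1 huv
    exact ⟨p, hmem u v huv.ne p hu hv⟩)
  refine ⟨R', ?_, ?_, ?_, ?_⟩
  · intro u
    refine le_trans ?_ (hk' u)
    refine Set.ncard_le_ncard ?_ (R.path u).bendSet_finite
    intro x hx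
    rw [hR'] at hx
    exact GridPath.bend_of_infix (hQ u) hx
  · rintro u v huv p ⟨hp1, hp2⟩ q ⟨hq1, hq2⟩
    rw [hR'] at hp1 hp2 hq1 hq2
    exact ha u v huv p q ((hQ u).subset hp1) ((hQ v).subset hp2) ((hQ u).subset hq1)
      ((hQ v).subset hq2)
  · intro u
    constructor
    · rintro ⟨v, hvu, p, hpe, hpi, hpn⟩
      rw [hR'] at hpe hpi hpn
      by_contra h3
      exact hpn (hQe u h3 p ⟨(hQ u).subset hpi, v, hvu, (hQ v).subset hpe.mem⟩)
    · intro h3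
      by_contra hno
      have hall : ∀ v, v ∈ G.neighborSet u → ∃ p, (R'.path u).IsEndpoint p ∧
          p ∈ (R'.path v).pts := by
        intro v hv
        have huv : u ≠ v := SimpleGraph.Adj.ne hv
        obtain ⟨p, hpu, hpv⟩ := (R'.adj_iff u v huv).1 hv
        refine ⟨p, ?_, hpv⟩
        by_contra he
        exact hno ⟨v, huv.symm, p,
          (R'.interiorly_disjoint u v huv p hpu hpv).resolve_left he, hpu, he⟩
      have hex : ∀ v, ∃ p, v ∈ G.neighborSet u → (R'.path u).IsEndpoint p ∧
          p ∈ (R'.path v).pts := by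
        intro v
        by_cases hv : v ∈ G.neighborSet u
        · obtain ⟨p, hp⟩ := hall v hv
          exact ⟨p, fun _ => hp⟩
        · exact ⟨0, fun h => (hv h).elim⟩
      choose f hf using hex
      have hle : (G.neighborSet u).ncard ≤
          ({(R'.path u).first, (R'.path u).last} : Set (ℤ × ℤ)).ncard := by
        refine Set.ncard_le_ncard_of_injOn f ?_ ?_ (Set.toFinite _)
        · intro v hv
          exact (hf v hv).1
        · intro v hv w hw hvw
          have huv : u ≠ v := SimpleGraph.Adj.ne hv
          have huw : u ≠ w := SimpleGraph.Adj.ne hw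
          have h1 := (hf v hv).1.mem
          have h2 := (hf v hv).2
          have h3 := (hf w hw).2
          rw [← hvw] at h3
          rcases R'.two_paths htf huv h1 h2 h3 with h | h
          · exact (huw h.symm).elim
          · exact h.symm
      have h2 := Set.ncard_insert_le (R'.path u).first {(R'.path u).last}
      rw [Set.ncard_singleton] at h2
      omega
  · intro u v huv p hu hv
    rw [hR'] at *
    have hu' := (hQ u).subset hu
    have hv' := (hQ v).subset hv
    exact ⟨fun h => hc u v huv p hv' (GridPath.bend_of_infix (hQ u) h),
      fun h => hc v u huv.symm p hu' (GridPath.bend_of_infix (hQ v) h)⟩
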